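/- Let K̂ be a 3×3 complex matrix with simple spectrum and one zero eigenvalue, with SoV bases as in the orthogonality theorem (generic parameters). Let t₁,₀ = tr K̂ and t₂,₀ = ((tr K̂)² − tr(K̂²))/2. Then the covectors ⟨0| := ⟨h = (0,…,0)| and ⟨2| := ⟨h = (2,…,2)| are T₂^{(K̂)}-eigenstates: ⟨0|T₂^{(K̂)}(λ) = t₂,₀·d(λ−η)d(λ)·⟨0| and ⟨2|T₂^{(K̂)}(λ) = t₂,₀·d(λ−η)d(λ+η)·⟨2| for all λ; every SoV vector |h⟩ with h ∈ {1,2}^N satisfies T₂^{(K̂)}(λ)|h⟩ = t₂,₀·d(λ−η)d(λ+η)·|h⟩; and ⟨0| is also a T₁^{(K̂)}-eigenstate: ⟨0|T₁^{(K̂)}(λ) = t₁,₀·d(λ)·⟨0|. -/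

import Mathlib

open scoped BigOperators

namespace SoV

noncomputable section

/-- Quantum states of the gl₃ chain of length `N`: labels of the natural tensor basis
of `H = (ℂ³)^{⊗N}`. -/
abbrev St (N : ℕ) := Fin N → Fin 3
/-- The Hilbert space `H` (and its dual), realized as functions on basis labels. -/
abbrev Hsp (N : ℕ) := St N → ℂ
/-- Operators on `H`. -/
abbrev Op (N : ℕ) := Matrix (St N) (St N) ℂ

variable {N : ℕ}

/-- ξᵢ − ξⱼ ∉ {0, η, −η} for i ≠ j. -/
def InhomCond (η : ℂ) (ξ : Fin N → ℂ) : Prop :=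
  ∀ i j : Fin N, i ≠ j → ξ i - ξ j ≠ 0 ∧ ξ i - ξ j ≠ η ∧ ξ i - ξ j ≠ -η

/-- Vandermonde product `V(x₁,…,x_M) = ∏_{i<j} (x_j − x_i)`. -/
def Vdm {M : ℕ} (x : Fin M → ℂ) : ℂ :=
  ∏ j : Fin M, ∏ i ∈ Finset.univ.filter (fun i => i < j), (x j - x i)

/-- `d(λ) = ∏_a (λ − ξ_a)`. -/
def dfun (ξ : Fin N → ℂ) (lam : ℂ) : ℂ := ∏ a, (lam - ξ a)

/-- The quantum determinant at identity twist:
`q-det M^{(I)}(λ) = ∏_b (λ−ξ_b+η)(λ−ξ_b−η)(λ−ξ_b−2η)`. -/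
def qdetI (η : ℂ) (ξ : Fin N → ℂ) (lam : ℂ) : ℂ :=
  ∏ b, ((lam - ξ b + η) * (lam - ξ b - η) * (lam - ξ b - 2 * η))

/-- The rational gl₃ R-matrix `R_{a,n}(λ − ξ_n) = (λ−ξ_n)·Id + η·P` acting on the
auxiliary space (first factor) and the `n`-th site of the chain. -/
def Raux (η : ℂ) (ξ : Fin N → ℂ) (lam : ℂ) (n : Fin N) :
    Matrix (Fin 3 × St N) (Fin 3 × St N) ℂ := Matrix.of fun p q =>
  (lam - ξ n) * (if p = q then 1 else 0) +
    η * (if p.1 = q.2 n ∧ p.2 = Function.update q.2 n q.1 then 1 else 0)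

/-- The twist matrix `K` acting on the auxiliary space. -/
def Kaux (K : Matrix (Fin 3) (Fin 3) ℂ) :
    Matrix (Fin 3 × St N) (Fin 3 × St N) ℂ := Matrix.of fun p q =>
  K p.1 q.1 * (if p.2 = q.2 then 1 else 0)

/-- The monodromy matrix `M^{(K)}(λ) = K_a R_{a,N}(λ−ξ_N) ⋯ R_{a,1}(λ−ξ_1)`. -/
def monodromy (η : ℂ) (ξ : Fin N → ℂ) (K : Matrix (Fin 3) (Fin 3) ℂ) (lam : ℂ) :
    Matrix (Fin 3 × St N) (Fin 3 × St N) ℂ :=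
  Kaux K * ((List.ofFn fun n : Fin N => Raux η ξ lam n).reverse.prod)

/-- The transfer matrix `T₁^{(K)}(λ) = tr_a M^{(K)}(λ)`. -/
def T1 (η : ℂ) (ξ : Fin N → ℂ) (K : Matrix (Fin 3) (Fin 3) ℂ) (lam : ℂ) : Op N :=
  Matrix.of fun f g => ∑ v : Fin 3, monodromy η ξ K lam (v, f) (v, g)

/-- Embedding of an (aux ⊗ H)-operator using the first of two auxiliary spaces. -/
def emb1 (M : Matrix (Fin 3 × St N) (Fin 3 × St N) ℂ) :
    Matrix ((Fin 3 × Fin 3) × St N) ((Fin 3 × Fin 3) × St N) ℂ := Matrix.of fun p q =>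
  M (p.1.1, p.2) (q.1.1, q.2) * (if p.1.2 = q.1.2 then 1 else 0)

/-- Embedding of an (aux ⊗ H)-operator using the second of two auxiliary spaces. -/
def emb2 (M : Matrix (Fin 3 × St N) (Fin 3 × St N) ℂ) :
    Matrix ((Fin 3 × Fin 3) × St N) ((Fin 3 × Fin 3) × St N) ℂ := Matrix.of fun p q =>
  M (p.1.2, p.2) (q.1.2, q.2) * (if p.1.1 = q.1.1 then 1 else 0)

/-- The antisymmetrizer `P⁻₁₂` on the two auxiliary spaces (acting trivially on `H`). -/
def antisym2 : Matrix ((Fin 3 × Fin 3) × St N) ((Fin 3 × Fin 3) × St N) ℂ :=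
  Matrix.of fun p q =>
    (if p.2 = q.2 then 1 else 0) *
      ((2 : ℂ)⁻¹ * ((if p.1 = q.1 then 1 else 0) - (if p.1 = (q.1.2, q.1.1) then 1 else 0)))

/-- The fused transfer matrix
`T₂^{(K)}(λ) = tr_{12} [P⁻₁₂ M₁^{(K)}(λ) M₂^{(K)}(λ−η)]`. -/
def T2 (η : ℂ) (ξ : Fin N → ℂ) (K : Matrix (Fin 3) (Fin 3) ℂ) (lam : ℂ) : Op N :=
  Matrix.of fun f g => ∑ v : Fin 3 × Fin 3,
    ((antisym2 * emb1 (monodromy η ξ K lam) * emb2 (monodromy η ξ K (lam - η)) :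
      Matrix ((Fin 3 × Fin 3) × St N) ((Fin 3 × Fin 3) × St N) ℂ)) (v, f) (v, g)

/-- A matrix has simple spectrum iff its minimal and characteristic polynomials coincide. -/
def SimpleSpectrum (K : Matrix (Fin 3) (Fin 3) ℂ) : Prop := minpoly ℂ K = K.charpoly

/-- The conserved-charge product `∏_n T₂^{(K)}(ξ_n−η)^{δ_{h_n,0}} T₁^{(K)}(ξ_n)^{δ_{h_n,2}}`
generating the SoV co-vector basis. -/
def sovCovOp (η : ℂ) (ξ : Fin N → ℂ) (K : Matrix (Fin 3) (Fin 3) ℂ) (h : St N) : Op N :=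
  (List.ofFn fun n : Fin N =>
    T2 η ξ K (ξ n - η) ^ (if h n = 0 then 1 else 0) *
      T1 η ξ K (ξ n) ^ (if h n = 2 then 1 else 0)).prod

/-- The SoV co-vector `⟨h| = ⟨1| ∏_n T₂^{(K)}(ξ_n−η)^{δ_{h_n,0}} T₁^{(K)}(ξ_n)^{δ_{h_n,2}}`. -/
def sovCov (η : ℂ) (ξ : Fin N → ℂ) (K : Matrix (Fin 3) (Fin 3) ℂ) (L : Hsp N) (h : St N) :
    Hsp N := Matrix.vecMul L (sovCovOp η ξ K h)

/-- The conserved-charge product `∏_n T₂^{(K)}(ξ_n)^{δ_{h_n,1}} T₁^{(K)}(ξ_n)^{δ_{h_n,2}}`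
generating the SoV vector basis. -/
def sovVecOp (η : ℂ) (ξ : Fin N → ℂ) (K : Matrix (Fin 3) (Fin 3) ℂ) (h : St N) : Op N :=
  (List.ofFn fun n : Fin N =>
    T2 η ξ K (ξ n) ^ (if h n = 1 then 1 else 0) *
      T1 η ξ K (ξ n) ^ (if h n = 2 then 1 else 0)).prod

/-- The SoV vector `|h⟩ = ∏_n T₂^{(K)}(ξ_n)^{δ_{h_n,1}} T₁^{(K)}(ξ_n)^{δ_{h_n,2}} |0⟩`. -/
def sovVec (η : ℂ) (ξ : Fin N → ℂ) (K : Matrix (Fin 3) (Fin 3) ℂ) (R0 : Hsp N) (h : St N) :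
    Hsp N := Matrix.mulVec (sovVecOp η ξ K h) R0

/-- Pairing ⟨L|v⟩ between a co-vector and a vector. -/
def pair (L v : Hsp N) : ℂ := ∑ f, L f * v f

/-- A family of `3^N` (co-)vectors is a basis of `H`. -/
def IsBasisFamily (v : St N → Hsp N) : Prop :=
  LinearIndependent ℂ v ∧ Submodule.span ℂ (Set.range v) = ⊤

/-- The label `(0,…,0)`. -/
def zeroSt : St N := fun _ => 0

/-- `R0` is the reference vector `|0⟩`, characterized by `⟨k|0⟩ = ∏_a δ_{k_a,0}`. -/
def DualRef (η : ℂ) (ξ : Fin N → ℂ) (K : Matrix (Fin 3) (Fin 3) ℂ) (L R0 : Hsp N) : Prop :=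
  ∀ k : St N, pair (sovCov η ξ K L k) R0 = if k = zeroSt then 1 else 0

/-- The diagonal SoV coupling `N_h`. -/
def Nh (η : ℂ) (ξ : Fin N → ℂ) (h : St N) : ℂ :=
  (∏ a, dfun ξ (ξ a - η) / dfun ξ (ξ a - ((1 : ℂ) + (if h a = 0 then 0 else 1)) * η)) *
    Vdm ξ ^ 2 /
      (Vdm (fun a => ξ a - (if h a = 0 then 0 else 1 : ℂ) * η) *
        Vdm (fun a => ξ a - (if h a = 2 then 1 else 0 : ℂ) * η))

/-- The 3×3 Jordan-type matrix with diagonal `(k₀,k₁,k₂)` and superdiagonal `(y₁,y₂)`. -/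
def KJmat (k₀ k₁ k₂ y₁ y₂ : ℂ) : Matrix (Fin 3) (Fin 3) ℂ := !![k₀, y₁, 0; 0, k₁, y₂; 0, 0, k₂]

/-- `W` conjugates `K` to its Jordan form with data `(k₀,k₁,k₂,y₁,y₂)`. -/
def JordanData (K W : Matrix (Fin 3) (Fin 3) ℂ) (k₀ k₁ k₂ y₁ y₂ : ℂ) : Prop :=
  IsUnit W.det ∧ K = W * KJmat k₀ k₁ k₂ y₁ y₂ * W⁻¹

/-- The tensor product co-vector `⟨L| = (⊗_a (x,y,z)_a)·Γ_W⁻¹`. -/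
def tensorCov (W : Matrix (Fin 3) (Fin 3) ℂ) (x y z : ℂ) : Hsp N :=
  fun f => ∏ a, Matrix.vecMul ![x, y, z] W⁻¹ (f a)

/-- The tensor product vector `|R⟩ = Γ_W·(⊗_a (r,s,t)_aᵗ)`. -/
def tensorVec (W : Matrix (Fin 3) (Fin 3) ℂ) (r s t : ℂ) : Hsp N :=
  fun f => ∏ a, Matrix.mulVec W ![r, s, t] (f a)

/-- `1_k = {a : k_a = 1}`. -/
def ones (k : St N) : Finset (Fin N) := Finset.univ.filter fun a => k a = 1

/-- `n_k = ⌊#1_k / 2⌋`. -/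
def nhalf (k : St N) : ℕ := (ones k).card / 2

/-- `k_{α,β}^{(0,2)}`: the label `k` with entries in `α` set to `0` and entries in `β` set to `2`. -/
def kab (k : St N) (α β : Finset (Fin N)) : St N :=
  fun a => if a ∈ α then 0 else if a ∈ β then 2 else k a

end
end SoV

namespace SoV
noncomputable section
variable {N : ℕ}

/-- The label `(2,…,2)`. -/
def twoSt : St N := fun _ => 2

/-- `g` is an `A`-valued polynomial function (in Horner form) of degree at most `n`, with
coefficient `c` in degree `n`. -/
def IsPolyFun {V : Type*} [AddCommGroup V] [Module ℂ V] : ℕ → V → (ℂ → V) → Prop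
  | 0, c, g => ∀ x, g x = c
  | n + 1, c, g => ∃ q b, IsPolyFun n c q ∧ ∀ x, g x = x • q x + b

namespace IsPolyFun

variable {V W : Type*} [AddCommGroup V] [Module ℂ V] [AddCommGroup W] [Module ℂ W]

lemma map (φ : V →ₗ[ℂ] W) : ∀ {n : ℕ} {c : V} {g : ℂ → V}, IsPolyFun n c g →
    IsPolyFun n (φ c) fun x => φ (g x)
  | 0, _, _, h => fun x => congrArg φ (h x)
  | _ + 1, _, _, ⟨q, b, hq, hg⟩ => ⟨fun x => φ (q x), φ b, hq.map φ, fun x => by simp [hg x]⟩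

lemma add : ∀ {n : ℕ} {c c' : V} {g g' : ℂ → V}, IsPolyFun n c g → IsPolyFun n c' g' →
    IsPolyFun n (c + c') fun x => g x + g' x
  | 0, _, _, _, _, h, h' => fun x => congrArg₂ (· + ·) (h x) (h' x)
  | _ + 1, _, _, _, _, ⟨q, b, hq, hg⟩, ⟨q', b', hq', hg'⟩ =>
    ⟨fun x => q x + q' x, b + b', hq.add hq', fun x => by simp only [hg x, hg' x]; module⟩

lemma raise : ∀ {n : ℕ} {c : V} {g : ℂ → V}, IsPolyFun n c g → IsPolyFun (n + 1) 0 g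
  | 0, c, _, h => ⟨fun _ => 0, c, fun _ => rfl, fun x => by simp [h x]⟩
  | _ + 1, _, _, ⟨q, b, hq, hg⟩ => ⟨q, b, hq.raise, hg⟩

lemma exists_factor (a : ℂ) : ∀ {n : ℕ} {c : V} {g : ℂ → V}, IsPolyFun (n + 1) c g →
    ∃ q, IsPolyFun n c q ∧ ∀ x, g x = (x - a) • q x + g a
  | 0, _, _, ⟨q, b, hq, hg⟩ => ⟨q, hq, fun x => by rw [hg x, hg a, hq x, hq a]; module⟩
  | n + 1, c, _, ⟨q, b, hq, hg⟩ => by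
    obtain ⟨r, hr, hqr⟩ := hq.exists_factor a
    refine ⟨fun x => q x + a • r x, ?_, fun x => ?_⟩
    · simpa using hq.add (hr.map (LinearMap.lsmul ℂ V a)).raise
    · have h := hqr x
      simp only [hg x, hg a, h]; module

lemma eq_prod_smul {ι : Type*} {z : ι → ℂ} (hz : Function.Injective z) (s : Finset ι) :
    ∀ {c : V} {g : ℂ → V}, IsPolyFun s.card c g → (∀ i ∈ s, g (z i) = 0) →
      ∀ x, g x = (∏ i ∈ s, (x - z i)) • c := by
  classical
  induction s using Finset.induction_on with
  | empty => intro c g hg _ x; simpa using hg x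
  | insert i s hi ih =>
    intro c g hg h0 x
    rw [Finset.card_insert_of_notMem hi] at hg
    obtain ⟨q, hq, hgq⟩ := hg.exists_factor (z i)
    rw [h0 i (Finset.mem_insert_self i s)] at hgq
    have hq0 : ∀ j ∈ s, q (z j) = 0 := fun j hj => by
      have h := hgq (z j)
      rw [h0 j (Finset.mem_insert_of_mem hj), add_zero, eq_comm, smul_eq_zero, sub_eq_zero] at h
      exact h.resolve_left fun h => hi (hz h ▸ hj)
    rw [hgq x, ih hq hq0 x, Finset.prod_insert hi, add_zero, smul_smul]

lemma list_prod {B ι : Type*} [Ring B] [Algebra ℂ B] (b : ι → B) (l : List ι) :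
    IsPolyFun l.length (1 : B) fun x => (l.map fun i => x • (1 : B) + b i).prod := by
  induction l with
  | nil => exact fun _ => rfl
  | cons i l ih =>
    have h : IsPolyFun (l.length + 1) (1 : B)
        fun x => x • (l.map fun i => x • (1 : B) + b i).prod :=
      ⟨_, 0, ih, fun x => (add_zero _).symm⟩
    simpa [add_mul] using h.add (ih.map (LinearMap.mulLeft ℂ (b i))).raise

end IsPolyFun

section MatrixTools

variable {A : Type*} [Ring A]

lemma commute_ite_one (p : Prop) [Decidable p] (a : A) : Commute (if p then 1 else 0) a := by
  split_ifs
  exacts [Commute.one_left a, Commute.zero_left a]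

lemma trace_mul_comm_of_commute {m n : Type*} [Fintype m] [Fintype n] (X : Matrix m n A)
    (Y : Matrix n m A) (h : ∀ i j, Commute (X i j) (Y j i)) :
    (X * Y).trace = (Y * X).trace := by
  simp only [Matrix.trace, Matrix.diag, Matrix.mul_apply]
  rw [Finset.sum_comm]
  exact Finset.sum_congr rfl fun j _ => Finset.sum_congr rfl fun i _ => h i j

lemma commute_list_prod_apply {n ι : Type*} [Fintype n] [DecidableEq n] (X : ι → Matrix n n A)
    (a : A) (l : List ι) (h : ∀ p ∈ l, ∀ i j, Commute a (X p i j)) (i j : n) :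
    Commute a ((l.map X).prod i j) := by
  induction l generalizing i j with
  | nil =>
    rw [List.map_nil, List.prod_nil, Matrix.one_apply]
    split_ifs
    exacts [Commute.one_right a, Commute.zero_right a]
  | cons p l ih =>
    rw [List.map_cons, List.prod_cons, Matrix.mul_apply]
    exact Commute.sum_right _ _ _ fun k _ =>
      (h p List.mem_cons_self i k).mul_right (ih (fun q hq => h q (List.mem_cons_of_mem p hq)) k j)

/-- The Kronecker product of matrices with noncommuting entries. -/
def kron {n : Type*} (X Y : Matrix n n A) : Matrix (n × n) (n × n) A :=
  Matrix.kroneckerMap (· * ·) X Y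

lemma kron_apply {n : Type*} (X Y : Matrix n n A) (i j : n × n) :
    kron X Y i j = X i.1 j.1 * Y i.2 j.2 := rfl

variable {n : Type*}

lemma kron_one_one [DecidableEq n] : kron (1 : Matrix n n A) 1 = 1 :=
  Matrix.kroneckerMap_one_one _ (by simp) (by simp) (by simp)

lemma kron_mul_kron [Fintype n] (X Y X' Y' : Matrix n n A)
    (h : ∀ i j k l, Commute (Y i j) (X' k l)) :
    kron (X * Y) (X' * Y') = kron X X' * kron Y Y' := by
  ext ⟨i, k⟩ ⟨j, l⟩
  simp only [kron_apply, Matrix.mul_apply, Fintype.sum_prod_type, Finset.sum_mul_sum]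
  refine Finset.sum_congr rfl fun p _ => Finset.sum_congr rfl fun q _ => ?_
  rw [mul_assoc, mul_assoc, ← mul_assoc (Y p j), (h p j k q).eq, mul_assoc]

lemma trace_kron [Fintype n] (X Y : Matrix n n A) : (kron X Y).trace = X.trace * Y.trace := by
  simp [Matrix.trace, kron_apply, Fintype.sum_prod_type, Finset.sum_mul_sum]

variable [Fintype n] [DecidableEq n]

lemma kron_list_prod {ι : Type*} (X Y : ι → Matrix n n A)
    (h : ∀ p q, p ≠ q → ∀ i j k l, Commute (X p i j) (Y q k l)) {l : List ι} (hl : l.Nodup) :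
    kron (l.map X).prod (l.map Y).prod = (l.map fun p => kron (X p) (Y p)).prod := by
  induction l with
  | nil => exact kron_one_one
  | cons p l ih =>
    rw [List.nodup_cons] at hl
    simp only [List.map_cons, List.prod_cons]
    rw [kron_mul_kron, ih hl.2]
    intro i j k m
    exact (commute_list_prod_apply X _ l
      (fun q hq i' j' => (h q p (fun e => hl.1 (e ▸ hq)) i' j' k m).symm) i j).symm

variable (A n) in
/-- The permutation operator on the tensor square of the auxiliary space. -/
def swapMat : Matrix (n × n) (n × n) A := (1 : Matrix (n × n) (n × n) A).submatrix Prod.swap id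

lemma swapMat_mul {m : Type*} (F : Matrix (n × n) m A) :
    swapMat A n * F = F.submatrix Prod.swap id :=
  Matrix.one_submatrix_mul Prod.swap (Equiv.refl _) F

lemma swapMat_mul_self : swapMat A n * swapMat A n = 1 := by
  rw [swapMat_mul]
  ext i j
  simp [swapMat, Matrix.one_apply]

lemma mul_swapMat (F : Matrix (n × n) (n × n) A) : F * swapMat A n = F.submatrix id Prod.swap := by
  have : swapMat A n =
      (1 : Matrix (n × n) (n × n) A).submatrix (Equiv.prodComm n n) id := by ext; rfl
  rw [this, Matrix.mul_submatrix_one]; rfl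

end MatrixTools

section SiteOperators

variable {A : Type*} [Ring A]

/-- The Levi-Civita symbol. -/
def leviCivita : Fin 3 → Fin 3 → Fin 3 → ℤ :=
  ![![![0, 0, 0], ![0, 0, 1], ![0, -1, 0]], ![![0, 0, -1], ![0, 0, 0], ![1, 0, 0]],
    ![![0, 1, 0], ![-1, 0, 0], ![0, 0, 0]]]

variable (A) in
/-- The embedding of the dual of the auxiliary space as antisymmetric tensors. -/
def epsMat : Matrix (Fin 3 × Fin 3) (Fin 3) A :=
  Matrix.of fun p m => (leviCivita p.1 p.2 m : A)

variable (A) in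
lemma epsMat_mul_transpose :
    epsMat A * (epsMat A).transpose = 1 - swapMat A (Fin 3) := by
  ext ⟨i, k⟩ ⟨j, l⟩
  fin_cases i <;> fin_cases k <;> fin_cases j <;> fin_cases l <;>
    simp [epsMat, leviCivita, swapMat, Matrix.mul_apply, Fin.sum_univ_three, Matrix.one_apply]

variable (A) in
lemma transpose_mul_epsMat :
    (epsMat A).transpose * epsMat A = 2 • (1 : Matrix (Fin 3) (Fin 3) A) := by
  ext i j
  fin_cases i <;> fin_cases j <;>
    simp [epsMat, leviCivita, Matrix.mul_apply, Fintype.sum_prod_type, Fin.sum_univ_three] <;>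
    norm_num

variable (A) in
lemma swapMat_mul_epsMat :
    swapMat A (Fin 3) * epsMat A = -epsMat A := by
  rw [swapMat_mul]
  ext ⟨i, k⟩ m
  fin_cases i <;> fin_cases k <;> fin_cases m <;> simp [epsMat, leviCivita]

variable (A) in
/-- The singlet vector in the tensor product of the auxiliary space with its dual. -/
def singlet : Matrix (Fin 3 × Fin 3) Unit A := Matrix.of fun p _ => if p.1 = p.2 then 1 else 0

variable [Algebra ℂ A]

/-- The relations of a system of matrix units. -/
structure IsMatrixUnits (e : Fin 3 → Fin 3 → A) : Prop where
  mul : ∀ i j k l, e i j * e k l = if j = k then e i l else 0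
  sum : ∑ i, e i i = 1

/-- The Lax operator `u + η P` written with matrix units. -/
def lax (e : Fin 3 → Fin 3 → A) (η u : ℂ) : Matrix (Fin 3) (Fin 3) A :=
  u • 1 + η • Matrix.of fun i j => e j i

/-- The Lax operator with dual auxiliary space. -/
def dualLax (e : Fin 3 → Fin 3 → A) (η u : ℂ) : Matrix (Fin 3) (Fin 3) A :=
  (u + η) • 1 - η • Matrix.of e

variable {e : Fin 3 → Fin 3 → A}

lemma lax_apply (η u : ℂ) (i j : Fin 3) :
    lax e η u i j = u • (if i = j then 1 else 0) + η • e j i := by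
  simp [lax, Matrix.one_apply]

lemma dualLax_apply (η u : ℂ) (i j : Fin 3) :
    dualLax e η u i j = (u + η) • (if i = j then 1 else 0) - η • e i j := by
  simp [dualLax, Matrix.one_apply]

variable (A) in
/-- The braid form `u P + η` of the R-matrix. -/
def braid (η u : ℂ) : Matrix (Fin 3 × Fin 3) (Fin 3 × Fin 3) A := u • swapMat A (Fin 3) + η • 1

lemma IsMatrixUnits.braid_mul_kron (he : IsMatrixUnits e) (η x y : ℂ) :
    braid A η (x - y) * kron (lax e η x) (lax e η y) =
      kron (lax e η y) (lax e η x) * braid A η (x - y) := by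
  simp only [braid, add_mul, mul_add, Matrix.smul_mul, Matrix.mul_smul, one_mul, mul_one,
    swapMat_mul, mul_swapMat]
  ext ⟨i, k⟩ ⟨j, l⟩
  simp only [Matrix.add_apply, Matrix.smul_apply, Matrix.submatrix_apply, kron_apply, lax_apply,
    Prod.swap, id, mul_add, add_mul, smul_mul_assoc, mul_smul_comm, he.mul, smul_add]
  split_ifs <;> simp_all <;> module

lemma IsMatrixUnits.kron_mul_epsMat (he : IsMatrixUnits e) (η u : ℂ) :
    kron (lax e η u) (lax e η (u - η)) * epsMat A = (u - η) • (epsMat A * dualLax e η u) := by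
  have h2 : e 2 2 = 1 - e 0 0 - e 1 1 := by
    rw [← he.sum, Fin.sum_univ_three]; abel
  ext ⟨i, k⟩ m
  simp only [Matrix.smul_apply, Matrix.mul_apply, Fintype.sum_prod_type, Fin.sum_univ_three,
    kron_apply, lax_apply, dualLax_apply, epsMat, Matrix.of_apply, mul_add, add_mul, mul_sub,
    smul_mul_assoc, mul_smul_comm, he.mul]
  fin_cases i <;> fin_cases k <;> fin_cases m <;> simp [leviCivita, h2] <;> module

lemma IsMatrixUnits.swapMat_mul_kron (he : IsMatrixUnits e) (η : ℂ) :
    swapMat A (Fin 3) * kron (lax e η 0) (lax e η (0 - η)) =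
      -kron (lax e η 0) (lax e η (0 - η)) := by
  rw [swapMat_mul]
  ext ⟨i, k⟩ ⟨j, l⟩
  simp only [Matrix.neg_apply, Matrix.submatrix_apply, kron_apply, lax_apply,
    Prod.swap, id, mul_add, add_mul, smul_mul_assoc, mul_smul_comm, he.mul, smul_add]
  split_ifs <;> simp_all

lemma IsMatrixUnits.kron_mul_singlet (he : IsMatrixUnits e) (η u : ℂ) :
    kron (lax e η u) (dualLax e η (u - η)) * singlet A = (u ^ 2 - η ^ 2) • singlet A := by
  have h2 : e 2 2 = 1 - e 0 0 - e 1 1 := by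
    rw [← he.sum, Fin.sum_univ_three]; abel
  ext ⟨i, k⟩ m
  simp only [Matrix.smul_apply, Matrix.mul_apply, Fintype.sum_prod_type, Fin.sum_univ_three,
    kron_apply, lax_apply, dualLax_apply, singlet, Matrix.of_apply, add_mul, mul_sub,
    sub_mul, smul_mul_assoc, mul_smul_comm, he.mul]
  fin_cases i <;> fin_cases k <;> simp [h2] <;> module

lemma IsMatrixUnits.kron_eq_singlet_mul (he : IsMatrixUnits e) (η : ℂ) :
    kron (lax e η 0) (dualLax e η (0 - η)) =
      singlet A * (Matrix.of fun _ p => -(η ^ 2 • e p.1 p.2) : Matrix Unit (Fin 3 × Fin 3) A) := by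
  ext ⟨i, k⟩ ⟨j, l⟩
  simp only [Matrix.mul_apply, kron_apply, lax_apply, dualLax_apply, singlet, Matrix.of_apply,
    mul_sub, add_mul, smul_mul_assoc, mul_smul_comm, he.mul]
  split_ifs <;> simp_all [pow_two, smul_smul]

variable (A) in
/-- A twist matrix with scalar entries. -/
def scalarMat (K : Matrix (Fin 3) (Fin 3) ℂ) : Matrix (Fin 3) (Fin 3) A :=
  K.map (algebraMap ℂ A)

variable (A) in
lemma braid_mul_kron_scalarMat (K : Matrix (Fin 3) (Fin 3) ℂ) (η u : ℂ) :
    braid A η u * kron (scalarMat A K) (scalarMat A K) =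
      kron (scalarMat A K) (scalarMat A K) * braid A η u := by
  simp only [braid, add_mul, mul_add, Matrix.smul_mul, Matrix.mul_smul, one_mul, mul_one,
    swapMat_mul, mul_swapMat]
  congr 2
  ext ⟨i, k⟩ ⟨j, l⟩
  exact Algebra.commutes _ _

variable (A) in
lemma kron_scalarMat_mul_epsMat (K : Matrix (Fin 3) (Fin 3) ℂ) :
    kron (scalarMat A K) (scalarMat A K) * epsMat A =
      epsMat A * scalarMat A K.adjugate.transpose := by
  ext ⟨i, k⟩ m
  simp only [Matrix.mul_apply, Fintype.sum_prod_type, Fin.sum_univ_three, kron_apply, epsMat,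
    Matrix.of_apply, scalarMat, Matrix.map_apply, ← map_mul, Matrix.adjugate_fin_three,
    Matrix.transpose_apply, ← map_intCast (algebraMap ℂ A), ← map_add]
  congr 1
  fin_cases i <;> fin_cases k <;> fin_cases m <;> simp [leviCivita] <;> ring

variable (A) in
lemma kron_scalarMat_mul_singlet {K J : Matrix (Fin 3) (Fin 3) ℂ} (h : K * J = 0) :
    kron (scalarMat A K) (scalarMat A J.transpose) * singlet A = 0 := by
  have h' : scalarMat A K * scalarMat A J = 0 := by
    rw [scalarMat, scalarMat, ← Matrix.map_mul, h, Matrix.map_zero _ (map_zero _)]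
  ext ⟨i, k⟩ m
  rw [Matrix.zero_apply, ← Matrix.zero_apply (α := A) i k, ← h', Matrix.mul_apply,
    Fintype.sum_prod_type, Matrix.mul_apply]
  refine Finset.sum_congr rfl fun p _ => ?_
  rw [Finset.sum_eq_single p (fun q _ hq => by simp [singlet, hq.symm]) (by simp)]
  have h1 : singlet A (p, p) m = 1 := if_pos rfl
  rw [h1, mul_one]
  rfl

end SiteOperators

section Chain

variable {A : Type*} [Ring A] [Algebra ℂ A]

/-- Commuting systems of matrix units attached to the sites of a chain. -/
structure IsChain (E : Fin N → Fin 3 → Fin 3 → A) : Prop where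
  units : ∀ n, IsMatrixUnits (E n)
  comm : ∀ n m, n ≠ m → ∀ i j k l, Commute (E n i j) (E m k l)

/-- The monodromy matrix of a list of sites. -/
def mono (E : Fin N → Fin 3 → Fin 3 → A) (η : ℂ) (ξ : Fin N → ℂ) (K : Matrix (Fin 3) (Fin 3) ℂ)
    (l : List (Fin N)) (x : ℂ) : Matrix (Fin 3) (Fin 3) A :=
  scalarMat A K * (l.map fun n => lax (E n) η (x - ξ n)).prod

/-- The monodromy matrix of a list of sites with dual auxiliary space. -/
def dualMono (E : Fin N → Fin 3 → Fin 3 → A) (η : ℂ) (ξ : Fin N → ℂ)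
    (K : Matrix (Fin 3) (Fin 3) ℂ) (l : List (Fin N)) (x : ℂ) : Matrix (Fin 3) (Fin 3) A :=
  scalarMat A K.adjugate.transpose * (l.map fun n => dualLax (E n) η (x - ξ n)).prod

lemma commute_lax_lax {e f : Fin 3 → Fin 3 → A} (h : ∀ i j k l, Commute (e i j) (f k l))
    (η x y : ℂ) (i j k l : Fin 3) : Commute (lax e η x i j) (lax f η y k l) := by
  rw [lax_apply, lax_apply]
  exact ((commute_ite_one _ _).smul_left _).add_left
    ((((commute_ite_one _ _).symm.smul_right _).add_right ((h _ _ _ _).smul_right _)).smul_left _)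

lemma commute_lax_dualLax {e f : Fin 3 → Fin 3 → A} (h : ∀ i j k l, Commute (e i j) (f k l))
    (η x y : ℂ) (i j k l : Fin 3) : Commute (lax e η x i j) (dualLax f η y k l) := by
  rw [lax_apply, dualLax_apply]
  exact ((commute_ite_one _ _).smul_left _).add_left
    ((((commute_ite_one _ _).symm.smul_right _).sub_right ((h _ _ _ _).smul_right _)).smul_left _)

lemma trace_scalarMat (K : Matrix (Fin 3) (Fin 3) ℂ) :
    (scalarMat A K).trace = K.trace • (1 : A) := by
  simp [scalarMat, Matrix.trace, Finset.sum_smul, Algebra.algebraMap_eq_smul_one]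

lemma trace_adjugate_transpose (K : Matrix (Fin 3) (Fin 3) ℂ) :
    K.adjugate.transpose.trace = (K.trace ^ 2 - (K * K).trace) / 2 := by
  rw [Matrix.trace_transpose, Matrix.adjugate_fin_three]
  simp [Matrix.trace_fin_three, Matrix.mul_apply, Fin.sum_univ_three]
  ring

/-- The trace of the product with a fixed matrix, as a linear map. -/
def traceMulLeft (K : Matrix (Fin 3) (Fin 3) A) : Matrix (Fin 3) (Fin 3) A →ₗ[ℂ] A :=
  Matrix.traceLinearMap (Fin 3) ℂ A ∘ₗ LinearMap.mulLeft ℂ K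

variable (E : Fin N → Fin 3 → Fin 3 → A) (η : ℂ) (ξ : Fin N → ℂ) (K : Matrix (Fin 3) (Fin 3) ℂ)

lemma isPolyFun_trace_mono (l : List (Fin N)) :
    IsPolyFun l.length (K.trace • (1 : A)) fun x => (mono E η ξ K l x).trace := by
  have h := (IsPolyFun.list_prod (fun n => -ξ n • 1 + η • Matrix.of fun i j => E n j i) l).map
    (traceMulLeft (scalarMat A K))
  convert h using 1
  · simp [traceMulLeft, trace_scalarMat]
  · funext x
    have : ∀ n, x • (1 : Matrix (Fin 3) (Fin 3) A) +
        (-ξ n • 1 + η • Matrix.of fun i j => E n j i) = lax (E n) η (x - ξ n) :=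
      fun n => by rw [lax]; module
    simp only [this]
    rfl

lemma isPolyFun_trace_dualMono (l : List (Fin N)) :
    IsPolyFun l.length (((K.trace ^ 2 - (K * K).trace) / 2) • (1 : A))
      fun x => (dualMono E η ξ K l x).trace := by
  have h := (IsPolyFun.list_prod (fun n => (η - ξ n) • 1 - η • Matrix.of (E n)) l).map
    (traceMulLeft (scalarMat A K.adjugate.transpose))
  convert h using 1
  · simp [traceMulLeft, trace_scalarMat, ← trace_adjugate_transpose]
  · funext x
    have : ∀ n, x • (1 : Matrix (Fin 3) (Fin 3) A) + ((η - ξ n) • 1 - η • Matrix.of (E n)) =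
        dualLax (E n) η (x - ξ n) := fun n => by rw [dualLax]; module
    simp only [this]
    rfl

variable {E} {l : List (Fin N)}

lemma commute_scalarMat_apply (K : Matrix (Fin 3) (Fin 3) ℂ) (i j : Fin 3) (a : A) :
    Commute a (scalarMat A K i j) := (Algebra.commutes _ _).symm

namespace IsChain

lemma kron_mono (hE : IsChain E) (hl : l.Nodup) (x y : ℂ) :
    kron (mono E η ξ K l x) (mono E η ξ K l y) = kron (scalarMat A K) (scalarMat A K) *
      (l.map fun n => kron (lax (E n) η (x - ξ n)) (lax (E n) η (y - ξ n))).prod := by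
  rw [mono, mono, kron_mul_kron, kron_list_prod _ _ _ hl]
  · exact fun p q hpq i j k m => commute_lax_lax (hE.comm p q hpq) _ _ _ _ _ _ _
  · exact fun i j k m => commute_scalarMat_apply _ _ _ _

lemma kron_mono_dualMono (hE : IsChain E) (hl : l.Nodup) (x y : ℂ) :
    kron (mono E η ξ K l x) (dualMono E η ξ K l y) =
      kron (scalarMat A K) (scalarMat A K.adjugate.transpose) *
        (l.map fun n => kron (lax (E n) η (x - ξ n)) (dualLax (E n) η (y - ξ n))).prod := by
  rw [mono, dualMono, kron_mul_kron, kron_list_prod _ _ _ hl]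
  · exact fun p q hpq i j k m => commute_lax_dualLax (hE.comm p q hpq) _ _ _ _ _ _ _
  · exact fun i j k m => commute_scalarMat_apply _ _ _ _

lemma braid_mul_kron_mono (hE : IsChain E) (hl : l.Nodup) (x y : ℂ) :
    braid A η (x - y) * kron (mono E η ξ K l x) (mono E η ξ K l y) =
      kron (mono E η ξ K l y) (mono E η ξ K l x) * braid A η (x - y) := by
  rw [hE.kron_mono η ξ K hl, hE.kron_mono η ξ K hl]
  refine SemiconjBy.mul_right (braid_mul_kron_scalarMat A K η (x - y)) ?_
  clear hl
  induction l with
  | nil => exact SemiconjBy.one_right _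
  | cons n l ih =>
    simp only [List.map_cons, List.prod_cons]
    refine SemiconjBy.mul_right ?_ ih
    have h := (hE.units n).braid_mul_kron η (x - ξ n) (y - ξ n)
    rwa [sub_sub_sub_cancel_right] at h

lemma commute_trace_mono (hE : IsChain E) (hl : l.Nodup) (x y : ℂ) :
    Commute (mono E η ξ K l x).trace (mono E η ξ K l y).trace := by
  have key : ∀ x y : ℂ, (x - y) • ((mono E η ξ K l x).trace * (mono E η ξ K l y).trace -
      (mono E η ξ K l y).trace * (mono E η ξ K l x).trace) =
      η • ((swapMat A (Fin 3) * kron (mono E η ξ K l y) (mono E η ξ K l x)).trace -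
        (swapMat A (Fin 3) * kron (mono E η ξ K l x) (mono E η ξ K l y)).trace) := by
    intro x y
    have h := congrArg (fun F => (swapMat A (Fin 3) * F).trace)
      (hE.braid_mul_kron_mono η ξ K hl x y)
    simp only [braid, add_mul, mul_add, Matrix.smul_mul, Matrix.mul_smul, one_mul, mul_one,
      Matrix.trace_add, Matrix.trace_smul, ← mul_assoc, swapMat_mul_self, trace_kron] at h
    have h' : (swapMat A (Fin 3) * kron (mono E η ξ K l y) (mono E η ξ K l x) *
        swapMat A (Fin 3)).trace = (mono E η ξ K l y).trace * (mono E η ξ K l x).trace := by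
      rw [← trace_kron, mul_swapMat, swapMat_mul]
      exact Equiv.sum_comp (Equiv.prodComm (Fin 3) (Fin 3)) fun p =>
        kron (mono E η ξ K l y) (mono E η ξ K l x) p p
    rw [h'] at h
    rw [smul_sub, smul_sub, sub_eq_sub_iff_add_eq_add, h, add_comm]
  rcases eq_or_ne x y with rfl | hxy
  · exact Commute.refl _
  have h2 : (2 * (x - y)) • ((mono E η ξ K l x).trace * (mono E η ξ K l y).trace -
      (mono E η ξ K l y).trace * (mono E η ξ K l x).trace) = 0 := by
    have h := congrArg₂ (· + ·) (key x y) (key y x)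
    simp only [← smul_add, sub_add_sub_cancel, sub_self, smul_zero] at h
    rw [← h]
    module
  exact sub_eq_zero.mp ((smul_eq_zero.mp h2).resolve_left
    (mul_ne_zero two_ne_zero (sub_ne_zero.mpr hxy)))

lemma kron_mono_mul_epsMat (hE : IsChain E) (hl : l.Nodup) (x : ℂ) :
    kron (mono E η ξ K l x) (mono E η ξ K l (x - η)) * epsMat A =
      (l.map fun n => x - η - ξ n).prod • (epsMat A * dualMono E η ξ K l x) := by
  have h : (l.map fun n => kron (lax (E n) η (x - ξ n)) (lax (E n) η (x - η - ξ n))).prod *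
      epsMat A = (l.map fun n => x - η - ξ n).prod •
        (epsMat A * (l.map fun n => dualLax (E n) η (x - ξ n)).prod) := by
    clear hl
    induction l with
    | nil => simp
    | cons n l ih =>
      have h := (hE.units n).kron_mul_epsMat η (x - ξ n)
      rw [sub_right_comm] at h
      simp only [List.map_cons, List.prod_cons]
      rw [Matrix.mul_assoc, ih, Matrix.mul_smul, ← Matrix.mul_assoc, h, Matrix.smul_mul, smul_smul,
        Matrix.mul_assoc, mul_comm (x - η - ξ n)]
  rw [hE.kron_mono η ξ K hl, Matrix.mul_assoc, h, Matrix.mul_smul, ← Matrix.mul_assoc,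
    kron_scalarMat_mul_epsMat, Matrix.mul_assoc, dualMono]

lemma trace_antisymmetrizer (hE : IsChain E) (hl : l.Nodup) (x : ℂ) :
    ((1 - swapMat A (Fin 3)) * kron (mono E η ξ K l x) (mono E η ξ K l (x - η))).trace =
      (2 * (l.map fun n => x - η - ξ n).prod) • (dualMono E η ξ K l x).trace := by
  rw [← epsMat_mul_transpose, Matrix.mul_assoc, trace_mul_comm_of_commute, Matrix.mul_assoc,
    hE.kron_mono_mul_epsMat η ξ K hl, Matrix.mul_smul, ← Matrix.mul_assoc, transpose_mul_epsMat,
    Matrix.trace_smul, Matrix.smul_mul, Matrix.trace_smul, one_mul, mul_comm, mul_smul]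
  · module
  · exact fun i j => Int.cast_commute _ _

lemma swapMat_mul_kron_mono (hE : IsChain E) (hl : l.Nodup) {n : Fin N} (hn : n ∈ l) :
    swapMat A (Fin 3) * kron (mono E η ξ K l (ξ n)) (mono E η ξ K l (ξ n - η)) =
      -kron (mono E η ξ K l (ξ n)) (mono E η ξ K l (ξ n - η)) := by
  obtain ⟨l₁, l₂, rfl⟩ := List.append_of_mem hn
  have hl₁ := (List.nodup_append.mp hl).1
  set F := kron (lax (E n) η 0) (lax (E n) η (0 - η)) with hF
  have hFe : (2 : ℂ) • F = epsMat A * ((epsMat A).transpose * F) := by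
    rw [← Matrix.mul_assoc, epsMat_mul_transpose, sub_mul, one_mul, (hE.units n).swapMat_mul_kron,
      ← hF, sub_neg_eq_add, two_smul]
  obtain ⟨Z, hZ⟩ : ∃ Z : Matrix (Fin 3) (Fin 3 × Fin 3) A,
      (2 : ℂ) • kron (mono E η ξ K (l₁ ++ n :: l₂) (ξ n)) (mono E η ξ K (l₁ ++ n :: l₂) (ξ n - η)) =
        epsMat A * Z := by
    have h := hE.kron_mono_mul_epsMat η ξ K hl₁ (ξ n)
    rw [hE.kron_mono η ξ K hl₁] at h
    rw [hE.kron_mono η ξ K hl]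
    simp only [List.map_append, List.prod_append, List.map_cons, List.prod_cons]
    rw [sub_self, sub_right_comm, sub_self, ← hF, ← mul_assoc, ← mul_assoc, ← Matrix.smul_mul,
      ← Matrix.mul_smul, hFe, ← Matrix.mul_assoc, h, Matrix.smul_mul, Matrix.smul_mul,
      Matrix.mul_assoc, Matrix.mul_assoc, ← Matrix.mul_smul]
    exact ⟨_, rfl⟩
  refine smul_right_injective _ (two_ne_zero (α := ℂ)) ?_
  simp only [smul_neg]
  rw [← Matrix.mul_smul, hZ, ← Matrix.mul_assoc, swapMat_mul_epsMat, Matrix.neg_mul]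

lemma trace_mono_mul_trace_mono (hE : IsChain E) (hl : l.Nodup) {n : Fin N} (hn : n ∈ l) :
    ((1 - swapMat A (Fin 3)) * kron (mono E η ξ K l (ξ n)) (mono E η ξ K l (ξ n - η))).trace =
      (2 : ℂ) • ((mono E η ξ K l (ξ n)).trace * (mono E η ξ K l (ξ n - η)).trace) := by
  rw [sub_mul, one_mul, hE.swapMat_mul_kron_mono η ξ K hl hn, sub_neg_eq_add, Matrix.trace_add,
    trace_kron, two_smul]

lemma trace_mono_mul_trace_dualMono (hE : IsChain E) (hK : K.det = 0) (hl : l.Nodup) {n : Fin N}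
    (hn : n ∈ l) :
    (mono E η ξ K l (ξ n)).trace * (dualMono E η ξ K l (ξ n - η)).trace = 0 := by
  obtain ⟨l₁, l₂, rfl⟩ := List.append_of_mem hn
  rw [← trace_kron, hE.kron_mono_dualMono η ξ K hl]
  simp only [List.map_append, List.prod_append, List.map_cons, List.prod_cons]
  have h : ∃ c : ℂ, (l₁.map fun m =>
      kron (lax (E m) η (ξ n - ξ m)) (dualLax (E m) η (ξ n - η - ξ m))).prod * singlet A =
        c • singlet A := by
    clear hn hl
    induction l₁ with
    | nil => exact ⟨1, by simp⟩
    | cons m l₁ ih =>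
      obtain ⟨c, hc⟩ := ih
      have h := (hE.units m).kron_mul_singlet η (ξ n - ξ m)
      rw [sub_right_comm] at h
      simp only [List.map_cons, List.prod_cons]
      rw [Matrix.mul_assoc, hc, Matrix.mul_smul, h, smul_smul]
      exact ⟨_, rfl⟩
  obtain ⟨c, hc⟩ := h
  rw [sub_self, sub_right_comm, sub_self, (hE.units n).kron_eq_singlet_mul, ← mul_assoc,
    ← mul_assoc, ← Matrix.mul_assoc, Matrix.mul_assoc (kron _ _), hc, Matrix.mul_smul,
    kron_scalarMat_mul_singlet A (by rw [Matrix.mul_adjugate, hK, zero_smul]), smul_zero,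
    Matrix.zero_mul, zero_mul, Matrix.trace_zero]

end IsChain

end Chain

section Representation

/-- The matrix unit `e_{ab}` acting on the `n`-th site of the chain. -/
def siteUnit (n : Fin N) (a b : Fin 3) : Op N :=
  Matrix.of fun f g => if b = g n ∧ f = Function.update g n a then 1 else 0

lemma mul_siteUnit_apply (F : Op N) (n : Fin N) (a b : Fin 3) (f g : St N) :
    (F * siteUnit n a b) f g = if b = g n then F f (Function.update g n a) else 0 := by
  by_cases h : b = g n <;> simp [Matrix.mul_apply, siteUnit, h]

lemma isChain_siteUnit : IsChain (siteUnit (N := N)) where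
  units n :=
    { mul := fun i j k l => by
        ext f g
        rw [mul_siteUnit_apply]
        by_cases h : j = k <;> by_cases h' : l = g n <;> simp [siteUnit, h, h']
      sum := by
        ext f g
        simp only [Matrix.sum_apply, siteUnit, Matrix.of_apply, ite_and, Finset.sum_ite_eq',
          Finset.mem_univ, if_true, Function.update_eq_self, Matrix.one_apply] }
  comm n m hnm i j k l := by
    ext f g
    rw [mul_siteUnit_apply, mul_siteUnit_apply]
    simp only [siteUnit, Matrix.of_apply, Function.update_of_ne hnm, Function.update_of_ne hnm.symm,
      Function.update_comm hnm]
    split_ifs <;> simp_all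

/-- Matrices on the tensor product of an auxiliary space with the chain, viewed as matrices with
operator entries. -/
def blocks {I : Type*} [Fintype I] [DecidableEq I] :
    Matrix I I (Op N) ≃+* Matrix (I × St N) (I × St N) ℂ :=
  Matrix.compRingEquiv I (St N) ℂ

lemma blocks_apply {I : Type*} [Fintype I] [DecidableEq I] (X : Matrix I I (Op N))
    (p q : I × St N) : blocks X p q = X p.1 q.1 p.2 q.2 := rfl

variable (η : ℂ) (ξ : Fin N → ℂ) (K : Matrix (Fin 3) (Fin 3) ℂ)

lemma Raux_eq_blocks (x : ℂ) (n : Fin N) :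
    Raux η ξ x n = blocks (lax (siteUnit n) η (x - ξ n)) := by
  ext ⟨i, f⟩ ⟨j, g⟩
  rw [blocks_apply, lax_apply]
  by_cases h : i = j <;> simp [Raux, siteUnit, Matrix.one_apply, h]

lemma Kaux_eq_blocks : (Kaux K : Matrix (Fin 3 × St N) (Fin 3 × St N) ℂ) =
    blocks (scalarMat (Op N) K) := by
  ext ⟨i, f⟩ ⟨j, g⟩
  simp [blocks_apply, Kaux, scalarMat, Matrix.algebraMap_matrix_apply]

/-- The sites of the chain, in the order of the factors of the monodromy matrix. -/
def sites (N : ℕ) : List (Fin N) := (List.finRange N).reverse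

lemma nodup_sites : (sites N).Nodup := List.nodup_reverse.mpr (List.nodup_finRange N)

lemma mem_sites (n : Fin N) : n ∈ sites N := List.mem_reverse.mpr (List.mem_finRange n)

lemma length_sites : (sites N).length = N := by simp [sites]

lemma prod_map_sites (x : ℂ) : ((sites N).map fun n => x - ξ n).prod = dfun ξ x := by
  rw [sites, List.map_reverse, List.prod_reverse, ← List.ofFn_eq_map, List.prod_ofFn, dfun]

lemma monodromy_eq_blocks (x : ℂ) :
    monodromy η ξ K x = blocks (mono siteUnit η ξ K (sites N) x) := by
  rw [monodromy, mono, map_mul, map_list_prod, Kaux_eq_blocks, List.ofFn_eq_map, sites,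
    ← List.map_reverse, List.map_map]
  simp only [Raux_eq_blocks]
  rfl

lemma T1_eq_trace (x : ℂ) : T1 η ξ K x = (mono siteUnit η ξ K (sites N) x).trace := by
  ext f g
  simp [T1, monodromy_eq_blocks, blocks_apply, Matrix.trace, Matrix.sum_apply]

/-- The transfer matrix with dual auxiliary space, which is `T₂` up to a scalar factor. -/
def dualT (x : ℂ) : Op N := (dualMono siteUnit η ξ K (sites N) x).trace

lemma emb1_blocks (X : Matrix (Fin 3) (Fin 3) (Op N)) : emb1 (blocks X) = blocks (kron X 1) := by
  ext ⟨⟨i, k⟩, f⟩ ⟨⟨j, l⟩, g⟩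
  by_cases h : k = l <;> simp [emb1, blocks_apply, kron_apply, h]

lemma emb2_blocks (X : Matrix (Fin 3) (Fin 3) (Op N)) : emb2 (blocks X) = blocks (kron 1 X) := by
  ext ⟨⟨i, k⟩, f⟩ ⟨⟨j, l⟩, g⟩
  by_cases h : i = j <;> simp [emb2, blocks_apply, kron_apply, h]

lemma antisym2_eq_blocks :
    (antisym2 : Matrix ((Fin 3 × Fin 3) × St N) ((Fin 3 × Fin 3) × St N) ℂ) =
      blocks ((2 : ℂ)⁻¹ • (1 - swapMat (Op N) (Fin 3))) := by
  ext ⟨⟨i, k⟩, f⟩ ⟨⟨j, l⟩, g⟩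
  simp only [antisym2, blocks_apply, swapMat, Matrix.smul_apply, Matrix.sub_apply, Matrix.one_apply,
    Matrix.submatrix_apply, Prod.swap, id, Matrix.of_apply, Prod.mk.injEq, and_comm (a := k = j)]
  by_cases hfg : f = g <;> split_ifs <;> simp [Matrix.one_apply, hfg]

lemma T2_eq_trace (x : ℂ) : T2 η ξ K x = (2 : ℂ)⁻¹ • ((1 - swapMat (Op N) (Fin 3)) *
    kron (mono siteUnit η ξ K (sites N) x) (mono siteUnit η ξ K (sites N) (x - η))).trace := by
  have h : kron (mono siteUnit η ξ K (sites N) x) (mono siteUnit η ξ K (sites N) (x - η)) =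
      kron (mono siteUnit η ξ K (sites N) x) 1 *
        kron 1 (mono siteUnit η ξ K (sites N) (x - η)) := by
    rw [← kron_mul_kron, mul_one, one_mul]
    intro i j k l
    rw [Matrix.one_apply]
    exact (commute_ite_one _ _)
  rw [h, ← Matrix.trace_smul, ← Matrix.smul_mul, ← mul_assoc]
  ext f g
  simp only [T2, monodromy_eq_blocks, emb1_blocks, emb2_blocks, antisym2_eq_blocks, ← map_mul,
    blocks_apply, Matrix.trace, Matrix.sum_apply, Matrix.of_apply, Matrix.diag]

lemma T2_eq_smul_dualT (x : ℂ) : T2 η ξ K x = dfun ξ (x - η) • dualT η ξ K x := by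
  rw [T2_eq_trace, isChain_siteUnit.trace_antisymmetrizer η ξ K nodup_sites, prod_map_sites,
    smul_smul, inv_mul_cancel_left₀ two_ne_zero, dualT]

lemma T2_eq_T1_mul_T1 (n : Fin N) :
    T2 η ξ K (ξ n) = T1 η ξ K (ξ n) * T1 η ξ K (ξ n - η) := by
  rw [T2_eq_trace, isChain_siteUnit.trace_mono_mul_trace_mono η ξ K nodup_sites (mem_sites n),
    smul_smul, inv_mul_cancel₀ two_ne_zero, one_smul, T1_eq_trace, T1_eq_trace]

lemma T1_mul_dualT (hK : K.det = 0) (n : Fin N) :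
    T1 η ξ K (ξ n) * dualT η ξ K (ξ n - η) = 0 := by
  rw [T1_eq_trace, dualT]
  exact isChain_siteUnit.trace_mono_mul_trace_dualMono η ξ K hK nodup_sites (mem_sites n)

lemma isPolyFun_T1 : IsPolyFun N (K.trace • (1 : Op N)) (T1 η ξ K) := by
  have h := isPolyFun_trace_mono siteUnit η ξ K (sites N)
  rw [length_sites] at h
  rwa [← funext (T1_eq_trace η ξ K)] at h

lemma isPolyFun_dualT :
    IsPolyFun N (((K.trace ^ 2 - (K * K).trace) / 2) • (1 : Op N)) (dualT η ξ K) := by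
  have h := isPolyFun_trace_dualMono siteUnit η ξ K (sites N)
  rwa [length_sites] at h

lemma commute_T1_T1 (x y : ℂ) : Commute (T1 η ξ K x) (T1 η ξ K y) := by
  rw [T1_eq_trace, T1_eq_trace]
  exact isChain_siteUnit.commute_trace_mono η ξ K nodup_sites x y

end Representation

lemma IsPolyFun.eq_dfun_smul {V : Type*} [AddCommGroup V] [Module ℂ V] {c : V} {g : ℂ → V}
    {z : Fin N → ℂ} (hz : Function.Injective z) (hg : IsPolyFun N c g) (h : ∀ n, g (z n) = 0)
    (x : ℂ) : g x = dfun z x • c :=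
  IsPolyFun.eq_prod_smul hz Finset.univ (by simpa using hg) (fun n _ => h n) x

section Spectrum

variable {η : ℂ} {ξ : Fin N → ℂ} {K : Matrix (Fin 3) (Fin 3) ℂ}

lemma InhomCond.injective (hξ : InhomCond η ξ) : Function.Injective ξ := by
  intro i j h
  by_contra hij
  exact (hξ i j hij).1 (sub_eq_zero.mpr h)

lemma InhomCond.dfun_ne_zero (hη : η ≠ 0) (hξ : InhomCond η ξ) (n : Fin N) :
    dfun ξ (ξ n - η) ≠ 0 := by
  refine Finset.prod_ne_zero_iff.mpr fun a _ h => ?_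
  rcases eq_or_ne n a with rfl | hna
  · exact hη (by linear_combination -h)
  · exact (hξ n a hna).2.1 (by linear_combination h)

lemma dualT_eq_smul (hη : η ≠ 0) (hξ : InhomCond η ξ) (K : Matrix (Fin 3) (Fin 3) ℂ) (n : Fin N) :
    dualT η ξ K (ξ n) =
      (dfun ξ (ξ n - η))⁻¹ • (T1 η ξ K (ξ n) * T1 η ξ K (ξ n - η)) := by
  rw [← T2_eq_T1_mul_T1, T2_eq_smul_dualT, smul_smul, inv_mul_cancel₀ (hξ.dfun_ne_zero hη n),
    one_smul]

lemma commute_dualT_of_commute (hξ : InhomCond η ξ) {X : Op N}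
    (h : ∀ n, Commute (dualT η ξ K (ξ n)) X) (x : ℂ) : Commute (dualT η ξ K x) X := by
  have hp := ((isPolyFun_dualT η ξ K).map (LinearMap.mulRight ℂ X - LinearMap.mulLeft ℂ X))
  have h0 := hp.eq_dfun_smul hξ.injective
    (fun n => by simpa using sub_eq_zero.mpr (h n).eq) x
  simp only [LinearMap.sub_apply, LinearMap.mulRight_apply, LinearMap.mulLeft_apply, smul_mul_assoc,
    mul_smul_comm, one_mul, mul_one, sub_self, smul_zero] at h0
  exact sub_eq_zero.mp h0

lemma commute_dualT_T1 (hη : η ≠ 0) (hξ : InhomCond η ξ) (K : Matrix (Fin 3) (Fin 3) ℂ) (x y : ℂ) :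
    Commute (dualT η ξ K x) (T1 η ξ K y) := by
  refine commute_dualT_of_commute hξ (fun n => ?_) x
  rw [dualT_eq_smul hη hξ]
  exact ((commute_T1_T1 η ξ K _ _).mul_left (commute_T1_T1 η ξ K _ _)).smul_left _

lemma commute_dualT_dualT (hη : η ≠ 0) (hξ : InhomCond η ξ) (K : Matrix (Fin 3) (Fin 3) ℂ)
    (x y : ℂ) : Commute (dualT η ξ K x) (dualT η ξ K y) := by
  refine commute_dualT_of_commute hξ (fun n => ?_) x
  rw [dualT_eq_smul hη hξ]
  exact ((commute_dualT_T1 hη hξ K _ _).symm.mul_left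
    (commute_dualT_T1 hη hξ K _ _).symm).smul_left _

lemma list_prod_mul_eq_zero {A : Type*} [Ring A] {y : A} {l : List A}
    (hl : ∀ b ∈ l, Commute b y) (h : ∃ b ∈ l, b * y = 0) : l.prod * y = 0 := by
  obtain ⟨b, hb, h0⟩ := h
  obtain ⟨l₁, l₂, rfl⟩ := List.append_of_mem hb
  have hc : Commute l₂.prod y :=
    Commute.list_prod_left _ _ fun c hc =>
      hl c (List.mem_append_right _ (List.mem_cons_of_mem b hc))
  rw [List.prod_append, List.prod_cons, mul_assoc, mul_assoc, hc.eq, ← mul_assoc b, h0, zero_mul,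
    mul_zero]

lemma mul_T2_eq_smul {z : Fin N → ℂ} (hz : Function.Injective z) {C : Op N}
    (hC : ∀ n, C * dualT η ξ K (z n) = 0) (x : ℂ) :
    C * T2 η ξ K x =
      ((K.trace ^ 2 - (K * K).trace) / 2 * dfun ξ (x - η) * dfun z x) • C := by
  have h : C * dualT η ξ K x =
      dfun z x • (C * (((K.trace ^ 2 - (K * K).trace) / 2) • (1 : Op N))) :=
    ((isPolyFun_dualT η ξ K).map (LinearMap.mulLeft ℂ C)).eq_dfun_smul hz hC x
  rw [T2_eq_smul_dualT, mul_smul_comm, h, mul_smul_comm, mul_one]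
  module

lemma mul_T1_eq_smul {z : Fin N → ℂ} (hz : Function.Injective z) {C : Op N}
    (hC : ∀ n, C * T1 η ξ K (z n) = 0) (x : ℂ) :
    C * T1 η ξ K x = (K.trace * dfun z x) • C := by
  have h : C * T1 η ξ K x = dfun z x • (C * (K.trace • (1 : Op N))) :=
    ((isPolyFun_T1 η ξ K).map (LinearMap.mulLeft ℂ C)).eq_dfun_smul hz hC x
  rw [h, mul_smul_comm, mul_one]
  module

lemma dfun_shift (ξ : Fin N → ℂ) (η x : ℂ) : dfun (fun n => ξ n - η) x = dfun ξ (x + η) :=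
  Finset.prod_congr rfl fun n _ => by ring

lemma sovCovOp_zeroSt :
    sovCovOp η ξ K zeroSt = (List.ofFn fun n => T2 η ξ K (ξ n - η)).prod := by
  simp [sovCovOp, zeroSt]

lemma sovCovOp_twoSt : sovCovOp η ξ K twoSt = (List.ofFn fun n => T1 η ξ K (ξ n)).prod := by
  simp [sovCovOp, twoSt]

lemma T1_mul_T2_shift (hK : K.det = 0) (n : Fin N) : T1 η ξ K (ξ n) * T2 η ξ K (ξ n - η) = 0 := by
  rw [T2_eq_smul_dualT, mul_smul_comm, T1_mul_dualT η ξ K hK, smul_zero]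

lemma commute_T2_T1 (hη : η ≠ 0) (hξ : InhomCond η ξ) (x y : ℂ) :
    Commute (T2 η ξ K x) (T1 η ξ K y) := by
  rw [T2_eq_smul_dualT]
  exact (commute_dualT_T1 hη hξ K _ _).smul_left _

lemma commute_T2_dualT (hη : η ≠ 0) (hξ : InhomCond η ξ) (x y : ℂ) :
    Commute (T2 η ξ K x) (dualT η ξ K y) := by
  rw [T2_eq_smul_dualT]
  exact (commute_dualT_dualT hη hξ K _ _).smul_left _

lemma sovCovOp_zeroSt_mul_T1 (hη : η ≠ 0) (hξ : InhomCond η ξ) (hK : K.det = 0) (n : Fin N) :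
    sovCovOp η ξ K zeroSt * T1 η ξ K (ξ n) = 0 := by
  rw [sovCovOp_zeroSt]
  refine list_prod_mul_eq_zero (fun b hb => ?_) ⟨_, List.mem_ofFn.mpr ⟨n, rfl⟩, ?_⟩
  · obtain ⟨m, rfl⟩ := List.mem_ofFn.mp hb
    exact commute_T2_T1 hη hξ _ _
  · rw [(commute_T2_T1 hη hξ _ _).eq, T1_mul_T2_shift hK]

lemma sovCovOp_zeroSt_mul_dualT (hη : η ≠ 0) (hξ : InhomCond η ξ) (hK : K.det = 0) (n : Fin N) :
    sovCovOp η ξ K zeroSt * dualT η ξ K (ξ n) = 0 := by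
  rw [dualT_eq_smul hη hξ, mul_smul_comm, ← mul_assoc, sovCovOp_zeroSt_mul_T1 hη hξ hK, zero_mul,
    smul_zero]

lemma sovCovOp_twoSt_mul_dualT (hη : η ≠ 0) (hξ : InhomCond η ξ) (hK : K.det = 0) (n : Fin N) :
    sovCovOp η ξ K twoSt * dualT η ξ K (ξ n - η) = 0 := by
  rw [sovCovOp_twoSt]
  refine list_prod_mul_eq_zero (fun b hb => ?_)
    ⟨_, List.mem_ofFn.mpr ⟨n, rfl⟩, T1_mul_dualT η ξ K hK n⟩
  obtain ⟨m, rfl⟩ := List.mem_ofFn.mp hb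
  exact (commute_dualT_T1 hη hξ K _ _).symm

lemma commute_sovVecOp_factor_dualT (hη : η ≠ 0) (hξ : InhomCond η ξ) (h : St N) (n : Fin N)
    (x : ℂ) : Commute (T2 η ξ K (ξ n) ^ (if h n = 1 then 1 else 0) *
      T1 η ξ K (ξ n) ^ (if h n = 2 then 1 else 0)) (dualT η ξ K x) :=
  ((commute_T2_dualT hη hξ _ _).pow_left _).mul_left
    ((commute_dualT_T1 hη hξ K _ _).symm.pow_left _)

lemma commute_sovVecOp_dualT (hη : η ≠ 0) (hξ : InhomCond η ξ) (h : St N) (x : ℂ) :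
    Commute (sovVecOp η ξ K h) (dualT η ξ K x) :=
  Commute.list_prod_left _ _ fun b hb => by
    obtain ⟨m, rfl⟩ := List.mem_ofFn.mp hb
    exact commute_sovVecOp_factor_dualT hη hξ h m x

lemma sovVecOp_mul_dualT (hη : η ≠ 0) (hξ : InhomCond η ξ) (hK : K.det = 0) {h : St N}
    (hh : ∀ a, h a ≠ 0) (n : Fin N) :
    sovVecOp η ξ K h * dualT η ξ K (ξ n - η) = 0 := by
  refine list_prod_mul_eq_zero (fun b hb => ?_) ⟨_, List.mem_ofFn.mpr ⟨n, rfl⟩, ?_⟩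
  · obtain ⟨m, rfl⟩ := List.mem_ofFn.mp hb
    exact commute_sovVecOp_factor_dualT hη hξ h m _
  · have h12 : h n = 1 ∨ h n = 2 := by
      have := hh n
      omega
    rcases h12 with h1 | h2
    · have : T1 η ξ K (ξ n) * T1 η ξ K (ξ n - η) * dualT η ξ K (ξ n - η) = 0 := by
        rw [(commute_T1_T1 η ξ K _ _).eq, mul_assoc, T1_mul_dualT η ξ K hK, mul_zero]
      simp [h1, T2_eq_T1_mul_T1, this]
    · simp [h2, T1_mul_dualT η ξ K hK]

end Spectrum

/-- with `t₁,₀ = tr K̂` and `t₂,₀ = ((tr K̂)² − tr K̂²)/2`, the SoV co-vectors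
`⟨0|`, `⟨2|` are `T₂^{(K̂)}`-eigenstates, every SoV vector `|h⟩` with `h ∈ {1,2}^N` is a
`T₂^{(K̂)}`-eigenstate, and `⟨0|` is also a `T₁^{(K̂)}`-eigenstate. -/
theorem statement_8 (N : ℕ) (η : ℂ) (hη : η ≠ 0) (ξ : Fin N → ℂ) (hξ : InhomCond η ξ)
    (Khat : Matrix (Fin 3) (Fin 3) ℂ) (hK : SimpleSpectrum Khat) (hdet : Khat.det = 0)
    (L R0 : Hsp N)
    (hbL : IsBasisFamily (sovCov η ξ Khat L))
    (hR0 : DualRef η ξ Khat L R0)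
    (hbR : IsBasisFamily (sovVec η ξ Khat R0)) :
    (∀ lam : ℂ,
      Matrix.vecMul (sovCov η ξ Khat L zeroSt) (T2 η ξ Khat lam) =
        (((Matrix.trace Khat) ^ 2 - Matrix.trace (Khat * Khat)) / 2 *
            dfun ξ (lam - η) * dfun ξ lam) • sovCov η ξ Khat L zeroSt) ∧
    (∀ lam : ℂ,
      Matrix.vecMul (sovCov η ξ Khat L twoSt) (T2 η ξ Khat lam) =
        (((Matrix.trace Khat) ^ 2 - Matrix.trace (Khat * Khat)) / 2 *
            dfun ξ (lam - η) * dfun ξ (lam + η)) • sovCov η ξ Khat L twoSt) ∧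
    (∀ h : St N, (∀ a, h a ≠ 0) → ∀ lam : ℂ,
      Matrix.mulVec (T2 η ξ Khat lam) (sovVec η ξ Khat R0 h) =
        (((Matrix.trace Khat) ^ 2 - Matrix.trace (Khat * Khat)) / 2 *
            dfun ξ (lam - η) * dfun ξ (lam + η)) • sovVec η ξ Khat R0 h) ∧
    (∀ lam : ℂ,
      Matrix.vecMul (sovCov η ξ Khat L zeroSt) (T1 η ξ Khat lam) =
        (Matrix.trace Khat * dfun ξ lam) • sovCov η ξ Khat L zeroSt) := by
  have hz : Function.Injective fun n => ξ n - η := fun i j h => hξ.injective (sub_left_injective h)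
  refine ⟨fun lam => ?_, fun lam => ?_, fun h hh lam => ?_, fun lam => ?_⟩
  · rw [sovCov, Matrix.vecMul_vecMul,
      mul_T2_eq_smul hξ.injective (sovCovOp_zeroSt_mul_dualT hη hξ hdet), Matrix.vecMul_smul]
  · rw [sovCov, Matrix.vecMul_vecMul, mul_T2_eq_smul hz (sovCovOp_twoSt_mul_dualT hη hξ hdet),
      Matrix.vecMul_smul, dfun_shift]
  · have hc : Commute (sovVecOp η ξ Khat h) (T2 η ξ Khat lam) := by
      rw [T2_eq_smul_dualT]
      exact (commute_sovVecOp_dualT hη hξ h lam).smul_right _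
    rw [sovVec, Matrix.mulVec_mulVec, ← hc.eq,
      mul_T2_eq_smul hz (sovVecOp_mul_dualT hη hξ hdet hh), Matrix.smul_mulVec, dfun_shift]
  · rw [sovCov, Matrix.vecMul_vecMul,
      mul_T1_eq_smul hξ.injective (sovCovOp_zeroSt_mul_T1 hη hξ hdet), Matrix.vecMul_smul]

end
end SoV
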